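/- Let 0 < p ≤ ∞, 0 < α < min{1,p}, β > 0 and s > 0 with s ≤ βα, and d ∈ ℕ. Write a_n = a_n(Id: G^{α,β,p}(T^d) → H^{s,p}(T^d)). Then lim_{n→∞} a_n · exp(β·(vol(B_p^d))^{−α/d}·n^{α/d}) · (vol(B_p^d))^{s/d} / n^{s/d} = 1, where B_p^d is the closed unit ball of ℓ_p^d and vol denotes Lebesgue volume. -/

import Mathlib

open MeasureTheory Real Filter
open scoped ENNReal NNReal BigOperators

noncomputable section

/-- The `d`-torus `T^d`, modeled as the cube `[0,2π]^d` with Lebesgue measure. -/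
def torusMeasure (d : ℕ) : Measure (Fin d → ℝ) :=
  volume.restrict (Set.univ.pi fun _ => Set.Icc 0 (2 * π))

/-- `L2(T^d)`. -/
abbrev TorusL2 (d : ℕ) := Lp ℂ 2 (torusMeasure d)

/-- The Fourier coefficient `c_k(f) = (2π)^{-d/2} ∫ f(x) e^{-i k·x} dx`. -/
def fourierCoeffT {d : ℕ} (f : TorusL2 d) (k : Fin d → ℤ) : ℂ :=
  (((2 * π) ^ (-(d : ℝ) / 2) : ℝ) : ℂ) *
    ∫ x, f x * Complex.exp (-Complex.I * ((∑ j, (k j : ℝ) * x j : ℝ) : ℂ)) ∂(torusMeasure d)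

/-- The squared `H^w(T^d)` norm `∑_k w(k)^2 |c_k(f)|^2`, valued in `ℝ≥0∞`. -/
def wNormSq {d : ℕ} (w : (Fin d → ℤ) → ℝ) (f : TorusL2 d) : ℝ≥0∞ :=
  ∑' k : Fin d → ℤ, ENNReal.ofReal (w k ^ 2 * ‖fourierCoeffT f k‖ ^ 2)

/-- The `n`-th approximation number `a_n(Id : H^{w₁}(T^d) → H^{w₂}(T^d))`: the infimum of all
worst-case error bounds `r ≥ 0` achievable by a linear map `A` of rank `< n`, where the error
`‖f - A f‖` is measured in the `H^{w₂}` norm on the unit ball of `H^{w₁}`.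
(With `w₂ ≡ 1` this is the approximation error in `L2(T^d)`, by Parseval.) -/
def approxNumber (d : ℕ) (w₁ w₂ : (Fin d → ℤ) → ℝ) (n : ℕ) : ℝ :=
  sInf { r : ℝ | 0 ≤ r ∧
    ∃ A : TorusL2 d →ₗ[ℂ] TorusL2 d,
      Module.Finite ℂ (LinearMap.range A) ∧
      Module.finrank ℂ (LinearMap.range A) < n ∧
      ∀ f : TorusL2 d, wNormSq w₁ f ≤ 1 →
        wNormSq w₂ (f - A f) ≤ ENNReal.ofReal r ^ 2 }

/-- constant weight `1`, defining `L2(T^d)` as a weighted space. -/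
def constOne (d : ℕ) : (Fin d → ℤ) → ℝ := fun _ => 1

/-- The `ℓ_p` (quasi-)norm on `ℝ^d`, for `0 < p ≤ ∞`. -/
def pNorm (d : ℕ) (p : ℝ≥0∞) (x : Fin d → ℝ) : ℝ :=
  if p = ∞ then ⨆ j, |x j| else (∑ j, |x j| ^ p.toReal) ^ (1 / p.toReal)

/-- The isotropic Sobolev weight `w_{s,p}`. -/
def wIso (d : ℕ) (s : ℝ) (p : ℝ≥0∞) (k : Fin d → ℤ) : ℝ :=
  if p = ∞ then (max 1 (⨆ j, |(k j : ℝ)|)) ^ s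
  else (1 + ∑ j, |(k j : ℝ)| ^ p.toReal) ^ (s / p.toReal)

/-- The Gevrey weight `w^G_{α,β,p}(k) = exp(β ‖k‖_p^α)`. -/
def wGevrey (d : ℕ) (α β : ℝ) (p : ℝ≥0∞) (k : Fin d → ℤ) : ℝ :=
  Real.exp (β * pNorm d p (fun j => (k j : ℝ)) ^ α)

/-- The covering number `N_ε(A)`: the minimal number of closed `ℓ_∞`-balls of radius `ε`
needed to cover `A` (note that on `Fin d → ℝ` the canonical metric is the sup-metric). -/
def coveringNumber {d : ℕ} (ε : ℝ) (A : Set (Fin d → ℝ)) : ℕ∞ :=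
  ⨅ (S : Finset (Fin d → ℝ)) (_ : A ⊆ ⋃ x ∈ S, Metric.closedBall x ε), (S.card : ℕ∞)

/-- The (non-dyadic) entropy number `ε_n(A, ℓ_∞^d)`. -/
def entropyNumber {d : ℕ} (n : ℕ) (A : Set (Fin d → ℝ)) : ℝ :=
  sInf { ε : ℝ | 0 < ε ∧ coveringNumber ε A ≤ (n : ℕ∞) }

/-- The grid number `G(A) = #(A ∩ ℤ^d)`. -/
def gridNumber {d : ℕ} (A : Set (Fin d → ℝ)) : ℕ∞ :=
  (A ∩ {x | ∀ i, ∃ m : ℤ, x i = (m : ℝ)}).encard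

/-- The closed unit ball `B_p^d` of `ℓ_p^d`. -/
def unitBallP (d : ℕ) (p : ℝ≥0∞) : Set (Fin d → ℝ) := {x | pNorm d p x ≤ 1}

end

noncomputable section

instance isFiniteMeasure_torusMeasure (d : ℕ) : IsFiniteMeasure (torusMeasure d) := by
  refine ⟨?_⟩
  rw [torusMeasure, Measure.restrict_apply_univ]
  exact (isCompact_univ_pi fun _ => isCompact_Icc).measure_lt_top

/-- The normalized trigonometric monomial `x ↦ (2π)^{-d/2} e^{i k·x}`. -/
def torusModeFun {d : ℕ} (k : Fin d → ℤ) (x : Fin d → ℝ) : ℂ :=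
  (((2 * π) ^ (-(d : ℝ) / 2) : ℝ) : ℂ) *
    Complex.exp (Complex.I * ((∑ j, (k j : ℝ) * x j : ℝ) : ℂ))

lemma memLp_torusModeFun {d : ℕ} (k : Fin d → ℤ) :
    MemLp (torusModeFun k) 2 (torusMeasure d) := by
  refine MemLp.of_bound ?_ ((2 * π) ^ (-(d : ℝ) / 2)) (Filter.Eventually.of_forall fun x => ?_)
  · apply Continuous.aestronglyMeasurable
    unfold torusModeFun
    fun_prop
  · rw [torusModeFun, norm_mul, mul_comm Complex.I, Complex.norm_exp_ofReal_mul_I, mul_one,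
      Complex.norm_real, Real.norm_of_nonneg (by positivity)]

/-- The trigonometric monomials as elements of `L2(T^d)`. -/
def torusMode {d : ℕ} (k : Fin d → ℤ) : TorusL2 d := (memLp_torusModeFun k).toLp _

lemma fourierCoeffT_eq_inner {d : ℕ} (f : TorusL2 d) (k : Fin d → ℤ) :
    fourierCoeffT f k = inner ℂ (torusMode k) f := by
  rw [fourierCoeffT, L2.inner_def, ← integral_const_mul]
  refine integral_congr_ae ?_
  filter_upwards [(memLp_torusModeFun k).coeFn_toLp] with x hx
  rw [torusMode, hx, RCLike.inner_apply, torusModeFun, map_mul, Complex.conj_ofReal,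
    ← Complex.exp_conj, map_mul, Complex.conj_I, Complex.conj_ofReal]
  ring

lemma integral_Icc_exp_int (m : ℤ) :
    ∫ x in Set.Icc (0 : ℝ) (2 * π), Complex.exp (Complex.I * ((m : ℂ) * x)) =
      if m = 0 then ((2 * π : ℝ) : ℂ) else 0 := by
  rw [integral_Icc_eq_integral_Ioc, ← intervalIntegral.integral_of_le (by positivity)]
  split_ifs with h
  · simp [h]
  · have hc : Complex.I * (m : ℂ) ≠ 0 := by simp [h]
    simp_rw [← mul_assoc]
    rw [integral_exp_mul_complex hc]
    have h1 : Complex.exp (Complex.I * m * ((2 * π : ℝ) : ℂ)) = 1 := by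
      rw [Complex.exp_eq_one_iff]
      exact ⟨m, by push_cast; ring⟩
    rw [h1]
    simp

lemma torusMeasure_eq_pi (d : ℕ) :
    torusMeasure d = Measure.pi fun _ : Fin d => volume.restrict (Set.Icc (0 : ℝ) (2 * π)) := by
  rw [torusMeasure, volume_pi, Measure.restrict_pi_pi]

lemma orthonormal_torusMode (d : ℕ) : Orthonormal ℂ (torusMode (d := d)) := by
  rw [orthonormal_iff_ite]
  intro k l
  rw [← fourierCoeffT_eq_inner, fourierCoeffT]
  have h1 : ∫ x, (torusMode l : TorusL2 d) x *
        Complex.exp (-Complex.I * ((∑ j, (k j : ℝ) * x j : ℝ) : ℂ)) ∂(torusMeasure d) =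
      (((2 * π) ^ (-(d : ℝ) / 2) : ℝ) : ℂ) *
        ∏ j, ∫ x in Set.Icc (0 : ℝ) (2 * π),
          Complex.exp (Complex.I * (((l j - k j : ℤ) : ℂ) * x)) := by
    rw [← integral_fintype_prod_eq_prod, ← torusMeasure_eq_pi, ← integral_const_mul]
    refine integral_congr_ae ?_
    filter_upwards [(memLp_torusModeFun l).coeFn_toLp] with x hx
    rw [torusMode, hx, torusModeFun, mul_assoc, ← Complex.exp_add, ← Complex.exp_sum]
    congr 2
    push_cast
    rw [← Finset.mul_sum, neg_mul, ← sub_eq_add_neg, ← mul_sub, ← Finset.sum_sub_distrib]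
    simp_rw [sub_mul]
  rw [h1]
  simp_rw [integral_Icc_exp_int, sub_eq_zero]
  split_ifs with h
  · subst h
    simp only [if_true, Finset.prod_const, Finset.card_univ, Fintype.card_fin]
    rw [← mul_assoc, ← Complex.ofReal_mul, ← Complex.ofReal_pow, ← Complex.ofReal_mul,
      ← Real.rpow_add (by positivity), ← Real.rpow_natCast, ← Real.rpow_add (by positivity)]
    rw [show -(d : ℝ) / 2 + -(d : ℝ) / 2 + d = 0 by ring, Real.rpow_zero, Complex.ofReal_one]
  · obtain ⟨j, hj⟩ := Function.ne_iff.1 h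
    rw [Finset.prod_eq_zero (Finset.mem_univ j) (if_neg (Ne.symm hj)), mul_zero, mul_zero]

lemma fourierCoeffT_sum_torusMode {d : ℕ} (S : Finset (Fin d → ℤ)) (c : (Fin d → ℤ) → ℂ)
    (k : Fin d → ℤ) :
    fourierCoeffT (∑ l ∈ S, c l • torusMode l) k = if k ∈ S then c k else 0 := by
  rw [fourierCoeffT_eq_inner, inner_sum]
  simp_rw [inner_smul_right, orthonormal_iff_ite.1 (orthonormal_torusMode d)]
  simp

lemma wNormSq_smul {d : ℕ} (w : (Fin d → ℤ) → ℝ) (c : ℂ) (f : TorusL2 d) :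
    wNormSq w (c • f) = ENNReal.ofReal (‖c‖ ^ 2) * wNormSq w f := by
  rw [wNormSq, wNormSq, ← ENNReal.tsum_mul_left]
  refine tsum_congr fun k => ?_
  rw [← ENNReal.ofReal_mul (by positivity), fourierCoeffT_eq_inner, fourierCoeffT_eq_inner,
    inner_smul_right, norm_mul]
  ring_nf

lemma wNormSq_sum_torusMode {d : ℕ} (w : (Fin d → ℤ) → ℝ) (S : Finset (Fin d → ℤ))
    (c : (Fin d → ℤ) → ℂ) :
    wNormSq w (∑ l ∈ S, c l • torusMode l) =
      ENNReal.ofReal (∑ k ∈ S, w k ^ 2 * ‖c k‖ ^ 2) := by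
  rw [wNormSq, tsum_eq_sum (s := S), ENNReal.ofReal_sum_of_nonneg fun _ _ => by positivity]
  · refine Finset.sum_congr rfl fun k hk => ?_
    rw [fourierCoeffT_sum_torusMode, if_pos hk]
  · intro k hk
    rw [fourierCoeffT_sum_torusMode, if_neg hk]
    simp

/-- Orthogonal projection onto the modes in `S`, as a linear map on `L2(T^d)`. -/
def modeProjection {d : ℕ} (S : Finset (Fin d → ℤ)) : TorusL2 d →ₗ[ℂ] TorusL2 d :=
  ∑ k ∈ S, ((innerSL ℂ (torusMode k)).toLinearMap).smulRight (torusMode k)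

lemma modeProjection_apply {d : ℕ} (S : Finset (Fin d → ℤ)) (f : TorusL2 d) :
    modeProjection S f = ∑ k ∈ S, fourierCoeffT f k • torusMode k := by
  simp [modeProjection, fourierCoeffT_eq_inner]

lemma range_modeProjection_le {d : ℕ} (S : Finset (Fin d → ℤ)) :
    LinearMap.range (modeProjection S) ≤
      Submodule.span ℂ (Set.range fun k : S => (torusMode (k : Fin d → ℤ) : TorusL2 d)) := by
  rintro _ ⟨f, rfl⟩
  rw [modeProjection_apply]
  exact Submodule.sum_mem _ fun k hk =>
    Submodule.smul_mem _ _ (Submodule.subset_span ⟨⟨k, hk⟩, rfl⟩)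

lemma finite_range_modeProjection {d : ℕ} (S : Finset (Fin d → ℤ)) :
    Module.Finite ℂ (LinearMap.range (modeProjection S)) := by
  have : FiniteDimensional ℂ (Submodule.span ℂ
      (Set.range fun k : S => (torusMode (k : Fin d → ℤ) : TorusL2 d))) :=
    FiniteDimensional.span_of_finite ℂ (Set.finite_range _)
  exact Submodule.finiteDimensional_of_le (range_modeProjection_le S)

lemma finrank_range_modeProjection_le {d : ℕ} (S : Finset (Fin d → ℤ)) :
    Module.finrank ℂ (LinearMap.range (modeProjection S)) ≤ S.card := by
  have : FiniteDimensional ℂ (Submodule.span ℂ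
      (Set.range fun k : S => (torusMode (k : Fin d → ℤ) : TorusL2 d))) :=
    FiniteDimensional.span_of_finite ℂ (Set.finite_range _)
  refine (Submodule.finrank_mono (range_modeProjection_le S)).trans ?_
  simpa [Set.finrank] using
    finrank_range_le_card (R := ℂ) fun k : S => (torusMode (k : Fin d → ℤ) : TorusL2 d)

lemma wNormSq_sub_modeProjection_le {d : ℕ} {w₁ w₂ : (Fin d → ℤ) → ℝ} {S : Finset (Fin d → ℤ)}
    {r : ℝ} (hw₂ : ∀ k, 0 ≤ w₂ k) (hr : 0 ≤ r) (h : ∀ k ∉ S, w₂ k ≤ r * w₁ k)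
    {f : TorusL2 d} (hf : wNormSq w₁ f ≤ 1) :
    wNormSq w₂ (f - modeProjection S f) ≤ ENNReal.ofReal r ^ 2 := by
  calc wNormSq w₂ (f - modeProjection S f)
      ≤ ENNReal.ofReal (r ^ 2) * wNormSq w₁ f := by
        rw [wNormSq, wNormSq, ← ENNReal.tsum_mul_left]
        refine ENNReal.tsum_le_tsum fun k => ?_
        rw [← ENNReal.ofReal_mul (by positivity)]
        apply ENNReal.ofReal_le_ofReal
        have hc : fourierCoeffT (f - modeProjection S f) k =
            if k ∈ S then 0 else fourierCoeffT f k := by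
          rw [fourierCoeffT_eq_inner, inner_sub_right, ← fourierCoeffT_eq_inner,
            ← fourierCoeffT_eq_inner, modeProjection_apply, fourierCoeffT_sum_torusMode]
          split_ifs <;> simp
        rw [hc]
        split_ifs with hk
        · rw [norm_zero, zero_pow two_ne_zero, mul_zero]
          positivity
        · rw [← mul_assoc, ← mul_pow r]
          have := hw₂ k
          have := h k hk
          gcongr
    _ ≤ ENNReal.ofReal (r ^ 2) * 1 := by gcongr
    _ = ENNReal.ofReal r ^ 2 := by rw [mul_one, ENNReal.ofReal_pow hr]

lemma exists_wNormSq_eq_one_of_finrank_lt {d n : ℕ} {w₁ : (Fin d → ℤ) → ℝ}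
    {S : Finset (Fin d → ℤ)} (hw₁ : ∀ k, 0 < w₁ k) (hS : n ≤ S.card)
    (A : TorusL2 d →ₗ[ℂ] TorusL2 d) (hA : Module.Finite ℂ (LinearMap.range A))
    (hAn : Module.finrank ℂ (LinearMap.range A) < n) :
    ∃ c : (Fin d → ℤ) → ℂ, A (∑ l ∈ S, c l • torusMode l) = 0 ∧
      wNormSq w₁ (∑ l ∈ S, c l • torusMode l) = 1 := by
  classical
  let B : (S → ℂ) →ₗ[ℂ] LinearMap.range A := A.rangeRestrict ∘ₗ
    Fintype.linearCombination ℂ fun k : S => (torusMode (k : Fin d → ℤ) : TorusL2 d)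
  have hB : LinearMap.ker B ≠ ⊥ :=
    LinearMap.ker_ne_bot_of_finrank_lt (by simpa using hAn.trans_le hS)
  obtain ⟨c₀, hc₀, hne⟩ := Submodule.exists_mem_ne_zero_of_ne_bot hB
  let c : (Fin d → ℤ) → ℂ := fun k => if h : k ∈ S then c₀ ⟨k, h⟩ else 0
  have hAc : A (∑ l ∈ S, c l • torusMode l) = 0 := by
    have h1 := congrArg Subtype.val (LinearMap.mem_ker.1 hc₀)
    simp only [B, LinearMap.comp_apply, Fintype.linearCombination_apply] at h1
    rw [← Finset.sum_attach]
    convert! h1 using 1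
    change _ = A _
    congr 1
    refine Finset.sum_congr rfl fun k _ => ?_
    simp [c]
  obtain ⟨k₀, hk₀⟩ := Function.ne_iff.1 hne
  set M := ∑ k ∈ S, w₁ k ^ 2 * ‖c k‖ ^ 2 with hM
  have hMpos : 0 < M := by
    refine Finset.sum_pos' (fun _ _ => by positivity) ⟨k₀, k₀.2, ?_⟩
    have h2 : c k₀ ≠ 0 := by simpa [c] using hk₀
    have := hw₁ k₀
    positivity
  refine ⟨fun l => ((√M)⁻¹ : ℝ) * c l, ?_, ?_⟩ <;>
    simp_rw [mul_smul, ← Finset.smul_sum]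
  · rw [map_smul, hAc, smul_zero]
  · rw [wNormSq_smul, wNormSq_sum_torusMode, ← hM, ← ENNReal.ofReal_mul (by positivity),
      Complex.norm_real, Real.norm_eq_abs, sq_abs, inv_pow, Real.sq_sqrt hMpos.le,
      inv_mul_cancel₀ hMpos.ne', ENNReal.ofReal_one]

/-- The approximation number of a diagonal embedding is squeezed between the values of the
quotient of the weights outside a set of fewer than `n` modes and on a set of at least `n`. -/
lemma approxNumber_mem_Icc {d n : ℕ} {w₁ w₂ : (Fin d → ℤ) → ℝ} {S T : Finset (Fin d → ℤ)}
    {r t : ℝ} (hw₁ : ∀ k, 0 < w₁ k) (hw₂ : ∀ k, 0 ≤ w₂ k) (hr : 0 ≤ r) (ht : 0 ≤ t)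
    (hS : S.card < n) (hSr : ∀ k ∉ S, w₂ k ≤ r * w₁ k)
    (hT : n ≤ T.card) (hTt : ∀ k ∈ T, t * w₁ k ≤ w₂ k) :
    approxNumber d w₁ w₂ n ∈ Set.Icc t r := by
  have hmem : r ∈ { r : ℝ | 0 ≤ r ∧
      ∃ A : TorusL2 d →ₗ[ℂ] TorusL2 d,
        Module.Finite ℂ (LinearMap.range A) ∧
        Module.finrank ℂ (LinearMap.range A) < n ∧
        ∀ f : TorusL2 d, wNormSq w₁ f ≤ 1 →
          wNormSq w₂ (f - A f) ≤ ENNReal.ofReal r ^ 2 } :=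
    ⟨hr, modeProjection S, finite_range_modeProjection S,
      (finrank_range_modeProjection_le S).trans_lt hS,
      fun f hf => wNormSq_sub_modeProjection_le hw₂ hr hSr hf⟩
  refine ⟨le_csInf ⟨r, hmem⟩ ?_, csInf_le ⟨0, fun _ h => h.1⟩ hmem⟩
  rintro b ⟨hb, A, hA, hAn, hAb⟩
  obtain ⟨c, hAc, hc⟩ := exists_wNormSq_eq_one_of_finrank_lt hw₁ hT A hA hAn
  have h1 := hAb _ hc.le
  rw [hAc, sub_zero, wNormSq_sum_torusMode, ← ENNReal.ofReal_pow hb,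
    ENNReal.ofReal_le_ofReal_iff (by positivity)] at h1
  rw [wNormSq_sum_torusMode, ENNReal.ofReal_eq_one] at hc
  refine (sq_le_sq₀ ht hb).1 ?_
  calc t ^ 2 = t ^ 2 * ∑ k ∈ T, w₁ k ^ 2 * ‖c k‖ ^ 2 := by rw [hc, mul_one]
    _ = ∑ k ∈ T, (t * w₁ k) ^ 2 * ‖c k‖ ^ 2 := by
        rw [Finset.mul_sum]
        exact Finset.sum_congr rfl fun k _ => by ring
    _ ≤ ∑ k ∈ T, w₂ k ^ 2 * ‖c k‖ ^ 2 := by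
        refine Finset.sum_le_sum fun k hk => ?_
        have := hTt k hk
        have := hw₁ k
        gcongr
    _ ≤ b ^ 2 := h1

lemma pNorm_top {d : ℕ} (x : Fin d → ℝ) : pNorm d ∞ x = ‖x‖ := by
  rw [pNorm, if_pos rfl]
  apply le_antisymm
  · exact Real.iSup_le (fun j => norm_le_pi_norm x j) (norm_nonneg x)
  · rw [pi_norm_le_iff_of_nonneg (Real.iSup_nonneg fun j => abs_nonneg _)]
    exact fun j => le_ciSup (f := fun j => |x j|) (Set.finite_range _).bddAbove j

lemma pNorm_of_ne_top {d : ℕ} {p : ℝ≥0∞} (hp : p ≠ ∞) (x : Fin d → ℝ) :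
    pNorm d p x = (∑ j, |x j| ^ p.toReal) ^ (1 / p.toReal) := if_neg hp

lemma pNorm_nonneg {d : ℕ} (p : ℝ≥0∞) (x : Fin d → ℝ) : 0 ≤ pNorm d p x := by
  rw [pNorm]
  split_ifs
  · exact Real.iSup_nonneg fun j => abs_nonneg _
  · positivity

lemma pNorm_rpow_toReal {d : ℕ} {p : ℝ≥0∞} (hp : 0 < p) (hp' : p ≠ ∞) (x : Fin d → ℝ) :
    pNorm d p x ^ p.toReal = ∑ j, |x j| ^ p.toReal := by
  rw [pNorm_of_ne_top hp', ← Real.rpow_mul (by positivity),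
    one_div_mul_cancel (ENNReal.toReal_pos hp.ne' hp').ne', Real.rpow_one]

lemma continuous_pNorm {d : ℕ} {p : ℝ≥0∞} (hp : 0 < p) : Continuous (pNorm d p) := by
  rcases eq_or_ne p ∞ with rfl | hp'
  · exact continuous_norm.congr fun x => (pNorm_top x).symm
  · have h := ENNReal.toReal_pos hp.ne' hp'
    have : Continuous fun x : Fin d → ℝ => (∑ j, |x j| ^ p.toReal) ^ (1 / p.toReal) := by
      refine Continuous.rpow_const (continuous_finsetSum _ fun j _ => ?_)
        fun _ => .inr (by positivity)
      exact Continuous.rpow_const (continuous_apply j).abs fun _ => .inr h.le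
    exact this.congr fun x => (pNorm_of_ne_top hp' x).symm

lemma pNorm_smul {d : ℕ} {p : ℝ≥0∞} (hp : 0 < p) (c : ℝ) (x : Fin d → ℝ) :
    pNorm d p (c • x) = |c| * pNorm d p x := by
  rcases eq_or_ne p ∞ with rfl | hp'
  · rw [pNorm_top, pNorm_top, norm_smul, Real.norm_eq_abs]
  · have h := ENNReal.toReal_pos hp.ne' hp'
    simp_rw [pNorm_of_ne_top hp', Pi.smul_apply, smul_eq_mul, abs_mul,
      Real.mul_rpow (abs_nonneg c) (abs_nonneg _)]
    rw [← Finset.mul_sum, Real.mul_rpow (by positivity) (by positivity),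
      ← Real.rpow_mul (abs_nonneg c), mul_one_div_cancel h.ne', Real.rpow_one]

lemma pNorm_neg {d : ℕ} {p : ℝ≥0∞} (hp : 0 < p) (x : Fin d → ℝ) :
    pNorm d p (-x) = pNorm d p x := by
  simpa using pNorm_smul hp (-1) x

lemma abs_apply_le_pNorm {d : ℕ} {p : ℝ≥0∞} (hp : 0 < p) (x : Fin d → ℝ) (j : Fin d) :
    |x j| ≤ pNorm d p x := by
  rcases eq_or_ne p ∞ with rfl | hp'
  · rw [pNorm_top]
    exact norm_le_pi_norm x j
  · have h := ENNReal.toReal_pos hp.ne' hp'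
    rw [← Real.rpow_le_rpow_iff (abs_nonneg _) (pNorm_nonneg p x) h, pNorm_rpow_toReal hp hp']
    exact Finset.single_le_sum (f := fun j => |x j| ^ p.toReal) (fun _ _ => by positivity)
      (Finset.mem_univ j)

/-- The exponent `min {1, p}` for which `‖·‖_p ^ q` satisfies the triangle inequality. -/
def quasiExponent (p : ℝ≥0∞) : ℝ := (min 1 p).toReal

lemma quasiExponent_pos {p : ℝ≥0∞} (hp : 0 < p) : 0 < quasiExponent p :=
  ENNReal.toReal_pos (by simp [hp.ne']) (by simp)

lemma pNorm_add_rpow_le {d : ℕ} {p : ℝ≥0∞} (hp : 0 < p) (x y : Fin d → ℝ) :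
    pNorm d p (x + y) ^ quasiExponent p ≤
      pNorm d p x ^ quasiExponent p + pNorm d p y ^ quasiExponent p := by
  rcases le_total 1 p with h1 | h1
  · rw [quasiExponent, min_eq_left h1]
    simp only [ENNReal.toReal_one, Real.rpow_one]
    rcases eq_or_ne p ∞ with rfl | hp'
    · simp_rw [pNorm_top]
      exact norm_add_le x y
    · simp_rw [pNorm_of_ne_top hp']
      exact Real.Lp_add_le _ _ _ (by simpa using ENNReal.toReal_mono hp' h1)
  · have hp' : p ≠ ∞ := (h1.trans_lt ENNReal.one_lt_top).ne
    have h := ENNReal.toReal_pos hp.ne' hp'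
    rw [quasiExponent, min_eq_right h1]
    simp_rw [pNorm_rpow_toReal hp hp']
    rw [← Finset.sum_add_distrib]
    refine Finset.sum_le_sum fun j _ => ?_
    have h2 : p.toReal ≤ 1 := by simpa using ENNReal.toReal_mono ENNReal.one_ne_top h1
    exact (Real.rpow_le_rpow (abs_nonneg _) (abs_add_le _ _) h.le).trans
      (Real.rpow_add_le_add_rpow (abs_nonneg _) (abs_nonneg _) h.le h2)

lemma finite_setOf_pNorm_intCast_le {d : ℕ} {p : ℝ≥0∞} (hp : 0 < p) (R : ℝ) :
    {k : Fin d → ℤ | pNorm d p (fun j => (k j : ℝ)) ≤ R}.Finite := by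
  refine (Set.Finite.pi' fun _ : Fin d => Set.finite_Icc (-⌈R⌉) ⌈R⌉).subset fun k hk j => ?_
  have h := (abs_le.1 ((abs_apply_le_pNorm hp (fun j => (k j : ℝ)) j).trans
    (hk.trans (Int.le_ceil R))))
  exact ⟨by exact_mod_cast h.1, by exact_mod_cast h.2⟩

/-- The lattice points in the ball of radius `R` of `ℓ_p^d`. -/
def latticeBall (d : ℕ) {p : ℝ≥0∞} (hp : 0 < p) (R : ℝ) : Finset (Fin d → ℤ) :=
  (finite_setOf_pNorm_intCast_le (d := d) hp R).toFinset

lemma mem_latticeBall {d : ℕ} {p : ℝ≥0∞} (hp : 0 < p) {R : ℝ} {k : Fin d → ℤ} :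
    k ∈ latticeBall d hp R ↔ pNorm d p (fun j => (k j : ℝ)) ≤ R := by
  simp [latticeBall]

/-- The half-open unit cell with lower corner `k`. -/
def unitCell {d : ℕ} (k : Fin d → ℤ) : Set (Fin d → ℝ) :=
  Set.univ.pi fun j => Set.Ico (k j : ℝ) (k j + 1)

lemma mem_unitCell {d : ℕ} {k : Fin d → ℤ} {x : Fin d → ℝ} :
    x ∈ unitCell k ↔ k = fun j => ⌊x j⌋ := by
  simp [unitCell, funext_iff, eq_comm (a := k _), Int.floor_eq_iff]

lemma volume_biUnion_unitCell {d : ℕ} (S : Finset (Fin d → ℤ)) :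
    volume (⋃ k ∈ S, unitCell k) = S.card := by
  rw [measure_biUnion_finset]
  · simp [unitCell, Real.volume_pi_Ico]
  · intro k _ l _ hkl
    refine Set.disjoint_left.2 fun x hk hl => hkl ?_
    rw [mem_unitCell.1 hk, mem_unitCell.1 hl]
  · exact fun k _ => MeasurableSet.univ_pi fun _ => measurableSet_Ico

/-- Rounding down changes `‖·‖_p ^ q` by at most a constant. -/
lemma exists_pNorm_floor_bound (d : ℕ) {p : ℝ≥0∞} (hp : 0 < p) :
    ∃ C > 0, ∀ x : Fin d → ℝ,
      pNorm d p (fun j => (⌊x j⌋ : ℝ)) ^ quasiExponent p ≤ pNorm d p x ^ quasiExponent p + C ∧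
      pNorm d p x ^ quasiExponent p ≤ pNorm d p (fun j => (⌊x j⌋ : ℝ)) ^ quasiExponent p + C := by
  have hq := quasiExponent_pos hp
  have hK : IsCompact (Set.univ.pi fun _ : Fin d => Set.Icc (0 : ℝ) 1) :=
    isCompact_univ_pi fun _ => isCompact_Icc
  obtain ⟨C, hC⟩ := hK.bddAbove_image
    (((continuous_pNorm hp).rpow_const fun _ => .inr hq.le).continuousOn
      (f := fun x => pNorm d p x ^ quasiExponent p))
  refine ⟨max C 1, by positivity, fun x => ?_⟩
  set k : Fin d → ℝ := fun j => (⌊x j⌋ : ℝ)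
  have hy : pNorm d p (x - k) ^ quasiExponent p ≤ max C 1 :=
    (hC ⟨x - k, fun j _ => ⟨Int.fract_nonneg (x j), (Int.fract_lt_one (x j)).le⟩, rfl⟩).trans
      (le_max_left _ _)
  have h1 := pNorm_add_rpow_le hp (x - k) k
  have h2 := pNorm_add_rpow_le hp (-(x - k)) x
  rw [pNorm_neg hp] at h2
  rw [sub_add_cancel] at h1
  rw [show -(x - k) + x = k by abel] at h2
  exact ⟨by linarith, by linarith⟩

open scoped Pointwise in
lemma volume_setOf_pNorm_le {d : ℕ} {p : ℝ≥0∞} (hp : 0 < p) {R : ℝ} (hR : 0 < R) :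
    volume {x : Fin d → ℝ | pNorm d p x ≤ R} =
      ENNReal.ofReal (R ^ d) * volume (unitBallP d p) := by
  have : {x : Fin d → ℝ | pNorm d p x ≤ R} = R • unitBallP d p := by
    ext x
    rw [Set.mem_smul_set_iff_inv_smul_mem₀ hR.ne', unitBallP, Set.mem_ofPred_eq, Set.mem_ofPred_eq,
      pNorm_smul hp, abs_inv, abs_of_pos hR, inv_mul_le_one₀ hR]
  rw [this, Measure.addHaar_smul_of_nonneg _ hR.le]
  simp

lemma volume_unitBallP_ne_top (d : ℕ) {p : ℝ≥0∞} (hp : 0 < p) :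
    volume (unitBallP d p) ≠ ∞ := by
  refine ((measure_mono fun x (hx : pNorm d p x ≤ 1) => ?_).trans_lt
    (isCompact_univ_pi fun _ : Fin d => isCompact_Icc (a := (-1 : ℝ)) (b := 1)).measure_lt_top).ne
  exact fun j _ => abs_le.1 ((abs_apply_le_pNorm hp x j).trans hx)

lemma volume_unitBallP_pos (d : ℕ) {p : ℝ≥0∞} (hp : 0 < p) :
    0 < (volume (unitBallP d p)).toReal := by
  refine ENNReal.toReal_pos (ne_of_gt ?_) (volume_unitBallP_ne_top d hp)
  have hopen : IsOpen {x : Fin d → ℝ | pNorm d p x < 1} :=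
    isOpen_lt (continuous_pNorm hp) continuous_const
  have h0 : pNorm d p 0 = 0 := by simpa using pNorm_smul hp 0 (0 : Fin d → ℝ)
  exact (hopen.measure_pos volume ⟨0, by simp [h0]⟩).trans_le
    (measure_mono fun x (hx : pNorm d p x < 1) => hx.le)

lemma toReal_volume_setOf_pNorm_le {d : ℕ} {p : ℝ≥0∞} (hp : 0 < p) {R : ℝ} (hR : 0 < R) :
    (volume {x : Fin d → ℝ | pNorm d p x ≤ R}).toReal =
      (volume (unitBallP d p)).toReal * R ^ d := by
  rw [volume_setOf_pNorm_le hp hR, ENNReal.toReal_mul, ENNReal.toReal_ofReal (by positivity),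
    mul_comm]

lemma volume_setOf_pNorm_le_ne_top {d : ℕ} {p : ℝ≥0∞} (hp : 0 < p) {R : ℝ} (hR : 0 < R) :
    volume {x : Fin d → ℝ | pNorm d p x ≤ R} ≠ ∞ := by
  rw [volume_setOf_pNorm_le hp hR]
  exact ENNReal.mul_ne_top ENNReal.ofReal_ne_top (volume_unitBallP_ne_top d hp)

/-- The number of lattice points in a ball, compared with the volume of nearby balls. -/
lemma exists_card_latticeBall_bounds (d : ℕ) {p : ℝ≥0∞} (hp : 0 < p) :
    ∃ C > 0, (∀ R ρ : ℝ, 0 ≤ R → 0 < ρ → R ^ quasiExponent p + C ≤ ρ ^ quasiExponent p →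
        ((latticeBall d hp R).card : ℝ) ≤ (volume (unitBallP d p)).toReal * ρ ^ d) ∧
      (∀ R ρ : ℝ, 0 ≤ R → 0 < ρ → ρ ^ quasiExponent p + C ≤ R ^ quasiExponent p →
        (volume (unitBallP d p)).toReal * ρ ^ d ≤ (latticeBall d hp R).card) := by
  have hq := quasiExponent_pos hp
  obtain ⟨C, hC0, hC⟩ := exists_pNorm_floor_bound d hp
  refine ⟨C, hC0, fun R ρ hR hρ h => ?_, fun R ρ hR hρ h => ?_⟩ <;>
    rw [← toReal_volume_setOf_pNorm_le hp hρ]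
  · rw [← ENNReal.toReal_natCast, ← volume_biUnion_unitCell]
    refine ENNReal.toReal_mono (volume_setOf_pNorm_le_ne_top hp hρ) (measure_mono ?_)
    refine Set.iUnion₂_subset fun k hk x hx => ?_
    rw [mem_latticeBall, mem_unitCell.1 hx] at hk
    rw [Set.mem_ofPred_eq, ← Real.rpow_le_rpow_iff (pNorm_nonneg p x) hρ.le hq]
    have h1 := Real.rpow_le_rpow (pNorm_nonneg p _) hk hq.le
    linarith [(hC x).2]
  · rw [← ENNReal.toReal_natCast, ← volume_biUnion_unitCell]
    refine ENNReal.toReal_mono ?_ (measure_mono fun x (hx : pNorm d p x ≤ ρ) => ?_)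
    · rw [volume_biUnion_unitCell]
      exact ENNReal.natCast_ne_top _
    · refine Set.mem_biUnion (x := fun j => ⌊x j⌋) ?_ (mem_unitCell.2 rfl)
      rw [Finset.mem_coe, mem_latticeBall, ← Real.rpow_le_rpow_iff (pNorm_nonneg p _) hR hq]
      have h1 := Real.rpow_le_rpow (pNorm_nonneg p x) hx hq.le
      linarith [(hC x).1]

/-- The Sobolev weight `w_{s,p}` as a function of `t = ‖k‖_p`. -/
def sobolevProfile (s : ℝ) (p : ℝ≥0∞) (t : ℝ) : ℝ :=
  if p = ∞ then max 1 t ^ s else (1 + t ^ p.toReal) ^ (s / p.toReal)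

lemma wIso_eq_sobolevProfile {d : ℕ} {p : ℝ≥0∞} (hp : 0 < p) (s : ℝ) (k : Fin d → ℤ) :
    wIso d s p k = sobolevProfile s p (pNorm d p fun j => (k j : ℝ)) := by
  rcases eq_or_ne p ∞ with rfl | hp'
  · simp [wIso, sobolevProfile, pNorm]
  · rw [wIso, sobolevProfile, if_neg hp', if_neg hp', pNorm_rpow_toReal hp hp']

lemma sobolevProfile_nonneg {s : ℝ} {p : ℝ≥0∞} {t : ℝ} (ht : 0 ≤ t) :
    0 ≤ sobolevProfile s p t := by
  rw [sobolevProfile]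
  split_ifs <;> positivity

lemma antitoneOn_log_one_add_rpow_sub {α β s γ : ℝ} (hα : 0 < α) (hαγ : α ≤ γ) (hs : 0 ≤ s)
    (hsβα : s ≤ β * α) :
    AntitoneOn (fun t : ℝ => s / γ * Real.log (1 + t ^ γ) - β * t ^ α) (Set.Ici 0) := by
  have hγ : 0 < γ := hα.trans_le hαγ
  have hderiv : ∀ t : ℝ, 0 < t → HasDerivAt
      (fun t : ℝ => s / γ * Real.log (1 + t ^ γ) - β * t ^ α)
      (s / γ * ((γ * t ^ (γ - 1)) / (1 + t ^ γ)) - β * (α * t ^ (α - 1))) t := by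
    intro t ht
    have hpos : 0 < t ^ γ := by positivity
    exact ((((Real.hasDerivAt_rpow_const (.inl ht.ne')).const_add 1).log
      (by positivity)).const_mul _).sub
      ((Real.hasDerivAt_rpow_const (.inl ht.ne')).const_mul β)
  refine antitoneOn_of_deriv_nonpos (convex_Ici 0) ?_ ?_ ?_
  · refine ContinuousOn.sub (ContinuousOn.mul continuousOn_const (ContinuousOn.log ?_ ?_)) ?_
    · exact (continuous_const.add (Real.continuous_rpow_const hγ.le)).continuousOn
    · intro t ht
      have : 0 ≤ t ^ γ := Real.rpow_nonneg ht γ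
      positivity
    · exact (continuous_const.mul (Real.continuous_rpow_const hα.le)).continuousOn
  · rw [interior_Ici]
    exact fun t ht => (hderiv t ht).differentiableAt.differentiableWithinAt
  · rw [interior_Ici]
    intro t (ht : 0 < t)
    rw [(hderiv t ht).deriv, sub_nonpos]
    have hle : t ^ (γ - α) ≤ 1 + t ^ γ := by
      rcases le_total t 1 with h | h
      · exact (Real.rpow_le_one ht.le h (by linarith)).trans (by linarith [Real.rpow_nonneg ht.le γ])
      · exact (Real.rpow_le_rpow_of_exponent_le h (sub_le_self γ hα.le)).trans (by linarith)
    have hsplit : t ^ (γ - 1) = t ^ (γ - α) * t ^ (α - 1) := by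
      rw [← Real.rpow_add ht]
      ring_nf
    have hden : 0 < 1 + t ^ γ := by positivity
    calc s / γ * ((γ * t ^ (γ - 1)) / (1 + t ^ γ))
        = s * (t ^ (γ - α) / (1 + t ^ γ)) * t ^ (α - 1) := by
          rw [hsplit]
          field_simp
      _ ≤ s * 1 * t ^ (α - 1) := by
          gcongr
          exact (div_le_one hden).2 hle
      _ ≤ β * α * 1 * t ^ (α - 1) := by gcongr
      _ = β * (α * t ^ (α - 1)) := by ring

lemma antitoneOn_log_max_one_sub {α β s : ℝ} (hα : 0 < α) (hβ : 0 ≤ β) (hsβα : s ≤ β * α) :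
    AntitoneOn (fun t : ℝ => s * Real.log (max 1 t) - β * t ^ α) (Set.Ici 0) := by
  intro u (hu : 0 ≤ u) v _ huv
  set a := max 1 u
  set b := max 1 v
  have ha : 1 ≤ a := le_max_left 1 u
  have hab : a ≤ b := max_le_max_left 1 huv
  have ha0 : 0 < a := by linarith
  have hb0 : 0 < b := by linarith
  have hpow : b ^ α - a ^ α ≤ v ^ α - u ^ α := by
    rcases le_total v 1 with h | h
    · have : a = b := by simp [a, b, h, huv.trans h]
      rw [this, sub_self]
      exact sub_nonneg.2 (Real.rpow_le_rpow hu huv hα.le)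
    · have hb : b = v := max_eq_right h
      rw [hb]
      exact sub_le_sub_left (Real.rpow_le_rpow hu (le_max_right 1 u) hα.le) _
  have ha1 : 1 ≤ a ^ α := Real.one_le_rpow ha hα.le
  have hlog : α * (Real.log b - Real.log a) ≤ b ^ α - a ^ α := by
    have h1 := Real.log_le_sub_one_of_pos (x := b ^ α / a ^ α) (by positivity)
    rw [Real.log_div (by positivity) (by positivity), Real.log_rpow hb0, Real.log_rpow ha0] at h1
    have h2 : b ^ α / a ^ α - 1 ≤ b ^ α - a ^ α := by
      rw [div_sub_one (by positivity)]
      exact div_le_self (sub_nonneg.2 (Real.rpow_le_rpow ha0.le hab hα.le)) ha1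
    linarith
  have hlog0 : 0 ≤ Real.log b - Real.log a := sub_nonneg.2 (Real.log_le_log ha0 hab)
  have h3 : s * (Real.log b - Real.log a) ≤ β * α * (Real.log b - Real.log a) := by gcongr
  have h4 : β * (α * (Real.log b - Real.log a)) ≤ β * (v ^ α - u ^ α) := by gcongr; linarith
  change s * Real.log b - β * v ^ α ≤ s * Real.log a - β * u ^ α
  linarith

/-- The quotient of the Sobolev and the Gevrey weight is nonincreasing in `‖k‖_p`. -/
lemma antitoneOn_sobolevProfile_mul_exp {p : ℝ≥0∞} (hp : 0 < p) {α β s : ℝ} (hα : 0 < α)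
    (hαp : ENNReal.ofReal α < p) (hβ : 0 ≤ β) (hs : 0 ≤ s) (hsβα : s ≤ β * α) :
    AntitoneOn (fun t : ℝ => sobolevProfile s p t * Real.exp (-(β * t ^ α))) (Set.Ici 0) := by
  rcases eq_or_ne p ∞ with rfl | hp'
  · refine (Real.exp_monotone.comp_antitoneOn
      (antitoneOn_log_max_one_sub hα hβ hsβα)).congr fun t _ => ?_
    have : 0 < max 1 t := by positivity
    rw [Function.comp_apply, sobolevProfile, if_pos rfl, Real.rpow_def_of_pos this,
      ← Real.exp_add]
    ring_nf
  · have hγ := ENNReal.toReal_pos hp.ne' hp'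
    refine (Real.exp_monotone.comp_antitoneOn (antitoneOn_log_one_add_rpow_sub hα
      ((ENNReal.ofReal_le_iff_le_toReal hp').1 hαp.le) hs hsβα)).congr fun t ht => ?_
    have : 0 < 1 + t ^ p.toReal := by
      have := Real.rpow_nonneg (Set.mem_Ici.1 ht) p.toReal
      positivity
    rw [Function.comp_apply, sobolevProfile, if_neg hp', Real.rpow_def_of_pos this,
      ← Real.exp_add]
    ring_nf

lemma tendsto_sobolevProfile_div_rpow {p : ℝ≥0∞} (hp : 0 < p) (s : ℝ) :
    Tendsto (fun t : ℝ => sobolevProfile s p t / t ^ s) atTop (nhds 1) := by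
  rcases eq_or_ne p ∞ with rfl | hp'
  · refine tendsto_const_nhds.congr' ?_
    filter_upwards [eventually_ge_atTop 1] with t ht
    have : 0 < t := by linarith
    rw [sobolevProfile, if_pos rfl, max_eq_right ht, div_self (by positivity)]
  · have hγ := ENNReal.toReal_pos hp.ne' hp'
    have h1 : Tendsto (fun t : ℝ => (1 + t ^ (-p.toReal)) ^ (s / p.toReal)) atTop (nhds 1) := by
      have h2 := ((tendsto_rpow_neg_atTop hγ).const_add 1).rpow_const
        (p := s / p.toReal) (.inl (by norm_num))
      simpa using h2
    refine h1.congr' ?_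
    filter_upwards [eventually_gt_atTop 0] with t ht
    have h3 : t ^ s = (t ^ p.toReal) ^ (s / p.toReal) := by
      rw [← Real.rpow_mul ht.le, mul_div_cancel₀ _ hγ.ne']
    rw [sobolevProfile, if_neg hp', h3, ← Real.div_rpow (by positivity) (by positivity),
      add_div, div_self (by positivity), Real.rpow_neg ht.le, one_div, add_comm]

lemma abs_one_add_rpow_sub_one_le {u θ : ℝ} (hu : -1 ≤ u) (hθ0 : 0 ≤ θ) (hθ1 : θ ≤ 1) :
    |(1 + u) ^ θ - 1| ≤ |u| := by
  have hnn : 0 ≤ 1 + u := by linarith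
  rcases le_total 0 u with h | h
  · have h1 : 1 ≤ (1 + u) ^ θ := Real.one_le_rpow (by linarith) hθ0
    have h2 : (1 + u) ^ θ ≤ 1 + u := by
      simpa using Real.rpow_le_rpow_of_exponent_le (x := 1 + u) (by linarith) hθ1
    rw [abs_of_nonneg (by linarith), abs_of_nonneg h]
    linarith
  · have h1 : (1 + u) ^ θ ≤ 1 := Real.rpow_le_one hnn (by linarith) hθ0
    have h2 : 1 + u ≤ (1 + u) ^ θ := by
      simpa using Real.rpow_le_rpow_of_exponent_ge_of_imp hnn (by linarith) hθ1
        (fun _ h0 => absurd h0 one_ne_zero)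
    rw [abs_of_nonpos (by linarith), abs_of_nonpos h]
    linarith

lemma tendsto_add_rpow_sub_rpow {θ : ℝ} (hθ0 : 0 ≤ θ) (hθ1 : θ < 1) (C : ℝ) :
    Tendsto (fun x : ℝ => (x + C) ^ θ - x ^ θ) atTop (nhds 0) := by
  have h1 : Tendsto (fun x : ℝ => |C| * x ^ (-(1 - θ))) atTop (nhds 0) := by
    simpa using (tendsto_rpow_neg_atTop (sub_pos.2 hθ1)).const_mul |C|
  refine squeeze_zero_norm' ?_ h1
  filter_upwards [eventually_gt_atTop 0, eventually_ge_atTop (-C)] with x hx hxC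
  have hu : -1 ≤ C / x := by
    rw [le_div_iff₀ hx]
    linarith
  have h2 : x + C = x * (1 + C / x) := by field_simp
  rw [h2, Real.mul_rpow hx.le (by linarith), ← mul_sub_one, norm_mul, Real.norm_of_nonneg
    (by positivity), Real.norm_eq_abs]
  calc x ^ θ * |(1 + C / x) ^ θ - 1| ≤ x ^ θ * |C / x| :=
        mul_le_mul_of_nonneg_left (abs_one_add_rpow_sub_one_le hu hθ0 hθ1.le) (by positivity)
    _ = |C| * x ^ (-(1 - θ)) := by
        rw [abs_div, abs_of_pos hx, neg_sub, Real.rpow_sub_one hx.ne']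
        ring

/-- Perturbing `ρ ^ q` by a constant does not affect the asymptotics of the weight quotient. -/
lemma tendsto_profile_perturbed {p : ℝ≥0∞} (hp : 0 < p) {α β s q : ℝ} (hα : 0 < α) (hαq : α < q)
    (C : ℝ) :
    Tendsto (fun ρ : ℝ =>
      sobolevProfile s p ((ρ ^ q + C) ^ q⁻¹) * Real.exp (-(β * ((ρ ^ q + C) ^ q⁻¹) ^ α)) *
        Real.exp (β * ρ ^ α) / ρ ^ s) atTop (nhds 1) := by
  have hq : 0 < q := hα.trans hαq
  have hx : Tendsto (fun ρ : ℝ => ρ ^ q) atTop atTop := tendsto_rpow_atTop hq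
  have hR : Tendsto (fun ρ : ℝ => (ρ ^ q + C) ^ q⁻¹) atTop atTop :=
    (tendsto_rpow_atTop (inv_pos.2 hq)).comp (tendsto_atTop_add_const_right _ C hx)
  have h1 := (tendsto_sobolevProfile_div_rpow hp s).comp hR
  have h2 : Tendsto (fun ρ : ℝ => ((1 + C * ρ ^ (-q)) ^ q⁻¹) ^ s) atTop (nhds 1) := by
    have h3 := (((tendsto_rpow_neg_atTop hq).const_mul C).const_add 1).rpow_const
      (p := q⁻¹) (.inl (by norm_num))
    have h4 := h3.rpow_const (p := s) (.inl (by norm_num))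
    simpa using h4
  have h5 : Tendsto (fun ρ : ℝ => Real.exp (-β * ((ρ ^ q + C) ^ (α / q) - (ρ ^ q) ^ (α / q))))
      atTop (nhds 1) := by
    have h6 := ((tendsto_add_rpow_sub_rpow (by positivity) ((div_lt_one hq).2 hαq) C).comp
      hx).const_mul (-β)
    rw [mul_zero] at h6
    simpa [Function.comp_def] using (Real.continuous_exp.tendsto 0).comp h6
  have h7 := (h1.mul h2).mul h5
  rw [one_mul, one_mul] at h7
  refine h7.congr' ?_
  filter_upwards [eventually_gt_atTop 0, hx.eventually_gt_atTop (-C)] with ρ hρ hρC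
  have hb : 0 < ρ ^ q + C := by linarith
  have h8 : (ρ ^ q + C) ^ q⁻¹ = ρ * (1 + C * ρ ^ (-q)) ^ q⁻¹ := by
    have h9 : ρ ^ q + C = ρ ^ q * (1 + C * ρ ^ (-q)) := by
      rw [Real.rpow_neg hρ.le]
      have : ρ ^ q ≠ 0 := by positivity
      field_simp
    have h10 : 0 ≤ 1 + C * ρ ^ (-q) := by
      rw [h9] at hb
      exact (pos_of_mul_pos_right hb (by positivity)).le
    rw [h9, Real.mul_rpow (by positivity) h10, Real.rpow_rpow_inv hρ.le hq.ne']
  have h11 : (1 + C * ρ ^ (-q)) ^ q⁻¹ = (ρ ^ q + C) ^ q⁻¹ / ρ := by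
    rw [h8]
    field_simp
  rw [Function.comp_apply, h11, Real.div_rpow (by positivity) hρ.le, ← Real.rpow_mul hb.le q⁻¹ α,
    ← Real.rpow_mul hρ.le q, mul_div_cancel₀ _ hq.ne', inv_mul_eq_div, mul_sub,
    sub_eq_add_neg, Real.exp_add, neg_mul, neg_mul, neg_neg]
  have : ((ρ ^ q + C) ^ q⁻¹) ^ s ≠ 0 := by positivity
  field_simp

lemma approxNumber_mem_Icc_of_latticeBall {d n : ℕ} {p : ℝ≥0∞} (hp : 0 < p) {α β s R R' : ℝ} (hα : 0 < α)
    (hαp : ENNReal.ofReal α < p) (hβ : 0 ≤ β) (hs : 0 ≤ s) (hsβα : s ≤ β * α)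
    (hR : 0 ≤ R) (hR' : 0 ≤ R') (hRn : (latticeBall d hp R).card < n)
    (hRn' : n ≤ (latticeBall d hp R').card) :
    approxNumber d (wGevrey d α β p) (wIso d s p) n ∈
      Set.Icc (sobolevProfile s p R' * Real.exp (-(β * R' ^ α)))
        (sobolevProfile s p R * Real.exp (-(β * R ^ α))) := by
  have hanti := antitoneOn_sobolevProfile_mul_exp hp hα hαp hβ hs hsβα
  have hquot : ∀ k : Fin d → ℤ, wIso d s p k =
      sobolevProfile s p (pNorm d p fun j => (k j : ℝ)) *
        Real.exp (-(β * (pNorm d p fun j => (k j : ℝ)) ^ α)) * wGevrey d α β p k := by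
    intro k
    rw [wGevrey, mul_assoc, ← Real.exp_add, neg_add_cancel, Real.exp_zero, mul_one,
      wIso_eq_sobolevProfile hp]
  have hpos : ∀ k, 0 < wGevrey d α β p k := fun k => Real.exp_pos _
  refine approxNumber_mem_Icc hpos (fun k => ?_) (mul_nonneg (sobolevProfile_nonneg hR)
    (Real.exp_pos _).le) (mul_nonneg (sobolevProfile_nonneg hR') (Real.exp_pos _).le) hRn
    (fun k hk => ?_) hRn' (fun k hk => ?_)
  · rw [wIso_eq_sobolevProfile hp]
    exact sobolevProfile_nonneg (pNorm_nonneg p _)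
  · rw [mem_latticeBall, not_le] at hk
    rw [hquot]
    exact mul_le_mul_of_nonneg_right (hanti hR (pNorm_nonneg p _) hk.le) (hpos k).le
  · rw [mem_latticeBall] at hk
    rw [hquot]
    exact mul_le_mul_of_nonneg_right (hanti (pNorm_nonneg p _) hR' hk) (hpos k).le

lemma lt_quasiExponent {p : ℝ≥0∞} {α : ℝ} (hα0 : 0 ≤ α) (hα1 : α < 1)
    (hαp : ENNReal.ofReal α < p) : α < quasiExponent p := by
  refine (ENNReal.ofReal_lt_iff_lt_toReal hα0 (by simp)).1 (lt_min ?_ hαp)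
  simpa using hα1

/-- the limit
`lim_n a_n(Id : G^{α,β,p} → H^{s,p}) · exp(β vol(B_p^d)^{-α/d} n^{α/d}) · vol(B_p^d)^{s/d} / n^{s/d} = 1`
for `0 < α < min{1,p}` and `0 < s ≤ βα`. -/
theorem statement17 (p : ℝ≥0∞) (hp : 0 < p) (α : ℝ) (hα0 : 0 < α) (hα1 : α < 1)
    (hαp : ENNReal.ofReal α < p) (β : ℝ) (hβ : 0 < β) (s : ℝ) (hs : 0 < s)
    (hsβα : s ≤ β * α) (d : ℕ) (hd : 0 < d) :
    Filter.Tendsto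
      (fun n : ℕ =>
        approxNumber d (wGevrey d α β p) (wIso d s p) n *
          Real.exp (β * (volume (unitBallP d p)).toReal ^ (-(α / (d : ℝ))) *
            (n : ℝ) ^ (α / (d : ℝ))) *
          (volume (unitBallP d p)).toReal ^ (s / (d : ℝ)) / (n : ℝ) ^ (s / (d : ℝ)))
      Filter.atTop (nhds 1) := by
  set V := (volume (unitBallP d p)).toReal with hVdef
  have hV : 0 < V := volume_unitBallP_pos d hp
  have hq := quasiExponent_pos hp
  have hαq := lt_quasiExponent hα0.le hα1 hαp
  set q := quasiExponent p
  obtain ⟨C, hC, hupper, hlower⟩ := exists_card_latticeBall_bounds d hp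
  have hd' : (0 : ℝ) < d := by exact_mod_cast hd
  have hρ : Tendsto (fun n : ℕ => ((n : ℝ) / V) ^ (1 / (d : ℝ))) atTop atTop :=
    (tendsto_rpow_atTop (by positivity)).comp
      (tendsto_natCast_atTop_atTop.atTop_div_const hV)
  have hlo := (tendsto_profile_perturbed (s := s) (β := β) hp hα0 hαq C).comp hρ
  have hhi := (tendsto_profile_perturbed (s := s) (β := β) hp hα0 hαq (-(2 * C))).comp hρ
  have hform : ∀ᶠ n : ℕ in atTop, ∀ a : ℝ,
      a * Real.exp (β * V ^ (-(α / (d : ℝ))) * (n : ℝ) ^ (α / (d : ℝ))) * V ^ (s / (d : ℝ)) /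
          (n : ℝ) ^ (s / (d : ℝ)) =
        a * Real.exp (β * (((n : ℝ) / V) ^ (1 / (d : ℝ))) ^ α) /
          (((n : ℝ) / V) ^ (1 / (d : ℝ))) ^ s := by
    filter_upwards [eventually_gt_atTop 0] with n hn a
    have hn' : (0 : ℝ) < n := by exact_mod_cast hn
    rw [← Real.rpow_mul (by positivity), ← Real.rpow_mul (by positivity), one_div_mul_eq_div,
      one_div_mul_eq_div, Real.div_rpow hn'.le hV.le, Real.div_rpow hn'.le hV.le,
      Real.rpow_neg hV.le, mul_assoc β, inv_mul_eq_div, div_div_eq_mul_div]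
  have hmem : ∀ᶠ n : ℕ in atTop, approxNumber d (wGevrey d α β p) (wIso d s p) n ∈ Set.Icc
      (sobolevProfile s p (((((n : ℝ) / V) ^ (1 / (d : ℝ))) ^ q + C) ^ q⁻¹) *
        Real.exp (-(β * (((((n : ℝ) / V) ^ (1 / (d : ℝ))) ^ q + C) ^ q⁻¹) ^ α)))
      (sobolevProfile s p (((((n : ℝ) / V) ^ (1 / (d : ℝ))) ^ q + -(2 * C)) ^ q⁻¹) *
        Real.exp (-(β * (((((n : ℝ) / V) ^ (1 / (d : ℝ))) ^ q + -(2 * C)) ^ q⁻¹) ^ α))) := by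
    filter_upwards [eventually_gt_atTop 0,
      ((tendsto_rpow_atTop hq).comp hρ).eventually_gt_atTop (2 * C)] with n hn hnC
    have hn' : (0 : ℝ) < n := by exact_mod_cast hn
    rw [Function.comp_apply] at hnC
    have hVρ : V * (((n : ℝ) / V) ^ (1 / (d : ℝ))) ^ d = n := by
      rw [← Real.rpow_natCast, ← Real.rpow_mul (by positivity), one_div_mul_cancel hd'.ne',
        Real.rpow_one, mul_div_cancel₀ _ hV.ne']
    have hρ0 : 0 < ((n : ℝ) / V) ^ (1 / (d : ℝ)) := by positivity
    set ρ := ((n : ℝ) / V) ^ (1 / (d : ℝ))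
    have hb : 0 ≤ ρ ^ q + -(2 * C) := by linarith
    have hb' : 0 ≤ ρ ^ q + C := by linarith
    have hb'' : 0 < ρ ^ q - C := by linarith
    refine approxNumber_mem_Icc_of_latticeBall hp hα0 hαp hβ.le hs.le hsβα (Real.rpow_nonneg hb _)
      (Real.rpow_nonneg hb' _) ?_ ?_
    · have h1 := hupper _ ((ρ ^ q - C) ^ q⁻¹) (Real.rpow_nonneg hb q⁻¹)
        (Real.rpow_pos_of_pos hb'' _) (by
          rw [Real.rpow_inv_rpow hb hq.ne', Real.rpow_inv_rpow hb''.le hq.ne']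
          linarith)
      have h2 : (ρ ^ q - C) ^ q⁻¹ < ρ := by
        rw [Real.rpow_inv_lt_iff_of_pos hb''.le hρ0.le hq]
        linarith
      have h3 : V * ((ρ ^ q - C) ^ q⁻¹) ^ d < V * ρ ^ d :=
        mul_lt_mul_of_pos_left (pow_lt_pow_left₀ h2 (Real.rpow_nonneg hb''.le _) hd.ne') hV
      exact_mod_cast (h1.trans_lt h3).trans_eq hVρ
    · have h1 := hlower _ ρ (Real.rpow_nonneg hb' q⁻¹) hρ0 (by
        rw [Real.rpow_inv_rpow hb' hq.ne'])
      exact_mod_cast hVρ.symm.trans_le h1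
  refine tendsto_of_tendsto_of_tendsto_of_le_of_le' hlo hhi ?_ ?_
  all_goals
    filter_upwards [hform, hmem] with n h1 h2
    rw [h1, Function.comp_apply]
    have hpos : 0 ≤ (((n : ℝ) / V) ^ (1 / (d : ℝ))) ^ s := by positivity
    refine div_le_div_of_nonneg_right (mul_le_mul_of_nonneg_right ?_ (Real.exp_pos _).le) hpos
  · exact h2.1
  · exact h2.2

end
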